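/- There exist β₀ > 0 and L > 0 such that for all β ≤ β₀, all h ≥ 0, all N ≥ 1, and all sequences (t₁,…,t_N) with t₁²+⋯+t_N² = 1, ν(exp(L^{-1}(Σ_{i=1}^N t_i σ̄_i)²)) ≤ L, where σ̄ = σ¹ − σ² is the difference of two independent replicas. -/

import Mathlib

open MeasureTheory ProbabilityTheory Finset

noncomputable section

/-- A spin configuration on `N` sites. -/
abbrev Cfg (N : ℕ) := Fin N → Bool

/-- The spin value `±1` of a Boolean. -/
def spin (b : Bool) : ℝ := if b then 1 else -1

/-- Minus the SK Hamiltonian. -/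
def negH (N : ℕ) (β h : ℝ) (g : Fin N → Fin N → ℝ) (σ : Cfg N) : ℝ :=
  (β / Real.sqrt N) *
      ∑ i : Fin N, ∑ j : Fin N, (if i < j then g i j * spin (σ i) * spin (σ j) else 0) +
    h * ∑ i : Fin N, spin (σ i)

/-- Gibbs average `⟨f⟩` of a function of `ι`-indexed replicas. -/
def gibbs (N : ℕ) (β h : ℝ) (g : Fin N → Fin N → ℝ) {ι : Type} [DecidableEq ι] [Fintype ι]
    (f : (ι → Cfg N) → ℝ) : ℝ :=
  (∑ σs : ι → Cfg N, f σs * ∏ l, Real.exp (negH N β h g (σs l))) /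
    (∑ σ : Cfg N, Real.exp (negH N β h g σ)) ^ (Fintype.card ι)

/-- The law of the disorder: i.i.d. standard Gaussians. -/
def gaussN (N : ℕ) : Measure (Fin N → Fin N → ℝ) :=
  Measure.pi fun _ => Measure.pi fun _ => gaussianReal 0 1

/-- `ν(f) = E⟨f⟩`. -/
def nu (N : ℕ) (β h : ℝ) {ι : Type} [DecidableEq ι] [Fintype ι]
    (f : (ι → Cfg N) → ℝ) : ℝ :=
  ∫ g, gibbs N β h g f ∂ gaussN N

/-- `S_l = Σ_i t_i (σ_i^{1(l)} - σ_i^{2(l)})`, replica pairs indexed by `Fin m × Fin 2`. -/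
def Sbar (N m : ℕ) (t : Fin N → ℝ) (σs : Fin m × Fin 2 → Cfg N) (l : Fin m) : ℝ :=
  ∑ i, t i * (spin (σs (l, 0) i) - spin (σs (l, 1) i))

/-- `a(k)`: the `k`-th moment of a standard Gaussian. -/
def gaussMoment (k : ℕ) : ℝ := ∫ x, x ^ k ∂ (gaussianReal 0 1 : Measure ℝ)

/-- The overlap `R_{l,l'}` of two configurations. -/
def overlap (N : ℕ) (σ τ : Cfg N) : ℝ := (∑ i, spin (σ i) * spin (τ i)) / N

/-- One-dimensional Brunn–Minkowski inequality, for midpoints of open sets. -/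
theorem volume_add_le_two_mul_of_midpoint {A B W : Set ℝ} (hA : IsOpen A) (hB : IsOpen B)
    (hA0 : A.Nonempty) (hB0 : B.Nonempty)
    (hW : ∀ a ∈ A, ∀ b ∈ B, (a + b) / 2 ∈ W) :
    volume A + volume B ≤ 2 * volume W := by
  have hcomp : ∀ K L : Set ℝ, K ⊆ A → L ⊆ B → IsCompact K → IsCompact L → K.Nonempty →
      L.Nonempty → volume K + volume L ≤ 2 * volume W := by
    intro K L hKA hLB hK hL hK0 hL0
    have hKm := hK.sSup_mem hK0
    have hLm := hL.sInf_mem hL0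
    set a := sSup K with ha
    set b := sInf L with hb
    have hscale : volume ((fun x : ℝ => 2⁻¹ * x) ⁻¹' W) = 2 * volume W := by
      rw [Real.volume_preimage_mul_left (by norm_num)]
      norm_num
    have h1 : volume ((fun x : ℝ => -b + x) ⁻¹' K) = volume K := measure_preimage_add _ _ _
    have h2 : volume ((fun x : ℝ => -a + x) ⁻¹' (L \ {b})) = volume L := by
      rw [measure_preimage_add, measure_sdiff_null (by simp)]
    rw [← hscale, ← h1, ← h2, ← measure_union]
    · apply measure_mono
      rintro x (hx | hx)
      · have := hW _ (hKA hx) _ (hLB hLm)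
        simp only [Set.mem_preimage]
        convert this using 1
        ring
      · have := hW _ (hKA hKm) _ (hLB hx.1)
        simp only [Set.mem_preimage]
        convert this using 1
        ring
    · rw [Set.disjoint_left]
      rintro x hx ⟨hx1, hx2⟩
      have e1 : -b + x ≤ a := le_csSup hK.bddAbove hx
      have e2 : b ≤ -a + x := csInf_le hL.bddBelow hx1
      exact hx2 (by simp only [Set.mem_singleton_iff]; linarith)
    · exact (hL.measurableSet.diff (measurableSet_singleton b)).preimage (by fun_prop)
  obtain ⟨a₀, ha₀⟩ := hA0
  obtain ⟨b₀, hb₀⟩ := hB0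
  rw [hA.measure_eq_iSup_isCompact, hB.measure_eq_iSup_isCompact]
  simp only [iSup_and']
  refine ENNReal.biSup_add_biSup_le' ⟨∅, by simp⟩ ⟨∅, by simp⟩ ?_
  rintro K ⟨hKA, hK⟩ L ⟨hLB, hL⟩
  calc volume K + volume L ≤ volume (insert a₀ K) + volume (insert b₀ L) :=
        add_le_add (measure_mono (Set.subset_insert _ _)) (measure_mono (Set.subset_insert _ _))
    _ ≤ _ := hcomp _ _ (Set.insert_subset ha₀ hKA) (Set.insert_subset hb₀ hLB) (hK.insert _)
        (hL.insert _) (Set.insert_nonempty _ _) (Set.insert_nonempty _ _)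

/-- The midpoint Prékopa–Leindler inequality on the line, for functions of supremum one. -/
theorem integral_add_integral_le_of_midpoint {f g w : ℝ → ℝ} (hf : Continuous f)
    (hg : Continuous g) (hfi : Integrable f) (hgi : Integrable g) (hwi : Integrable w)
    (hf0 : ∀ x, 0 ≤ f x) (hg0 : ∀ x, 0 ≤ g x) (hw0 : ∀ x, 0 ≤ w x)
    (hf1 : ∀ x, f x ≤ 1) (hg1 : ∀ x, g x ≤ 1)
    (hfs : ∀ t < 1, ∃ x, t < f x) (hgs : ∀ t < 1, ∃ x, t < g x)
    (hfgw : ∀ x y, f x * g y ≤ w ((x + y) / 2) ^ 2) :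
    (∫ x, f x) + ∫ x, g x ≤ 2 * ∫ x, w x := by
  have key : (∫⁻ x, ENNReal.ofReal (f x)) + ∫⁻ x, ENNReal.ofReal (g x) ≤
      2 * ∫⁻ x, ENNReal.ofReal (w x) := by
    rw [lintegral_eq_lintegral_meas_lt _ (ae_of_all _ hf0) hfi.aemeasurable,
      lintegral_eq_lintegral_meas_lt _ (ae_of_all _ hg0) hgi.aemeasurable,
      lintegral_eq_lintegral_meas_lt _ (ae_of_all _ hw0) hwi.aemeasurable,
      ← lintegral_add_left, ← lintegral_const_mul']
    · refine setLIntegral_mono' measurableSet_Ioi fun t ht => ?_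
      rcases lt_or_ge t 1 with h1 | h1
      · refine volume_add_le_two_mul_of_midpoint (isOpen_lt continuous_const hf)
          (isOpen_lt continuous_const hg) (hfs t h1) (hgs t h1) fun a ha b hb => ?_
        have ht : 0 < t := ht
        simp only [Set.mem_ofPred_eq] at ha hb ⊢
        have := hfgw a b
        refine lt_of_pow_lt_pow_left₀ 2 (hw0 _) (lt_of_lt_of_le ?_ this)
        nlinarith
      · have e1 : {a | t < f a} = ∅ := by
          ext x; simpa using (hf1 x).trans h1
        have e2 : {a | t < g a} = ∅ := by
          ext x; simpa using (hg1 x).trans h1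
        simp [e1, e2]
    · simp
    · exact Antitone.measurable fun s t hst => measure_mono fun x hx => lt_of_le_of_lt hst hx
  rw [← ofReal_integral_eq_lintegral_ofReal hfi (ae_of_all _ hf0),
    ← ofReal_integral_eq_lintegral_ofReal hgi (ae_of_all _ hg0),
    ← ofReal_integral_eq_lintegral_ofReal hwi (ae_of_all _ hw0),
    ← ENNReal.ofReal_add (integral_nonneg hf0) (integral_nonneg hg0),
    show (2 : ENNReal) = ENNReal.ofReal 2 by simp, ← ENNReal.ofReal_mul (by norm_num)] at key
  have hw : 0 ≤ ∫ x, w x := integral_nonneg fun x => hw0 x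
  exact (ENNReal.ofReal_le_ofReal_iff (by positivity)).1 key

/-- The midpoint Prékopa–Leindler inequality on the line. -/
theorem integral_mul_integral_le_sq_of_midpoint {f g w : ℝ → ℝ} (hf : Continuous f)
    (hg : Continuous g) (hfi : Integrable f) (hgi : Integrable g) (hwi : Integrable w)
    (hf0 : ∀ x, 0 < f x) (hg0 : ∀ x, 0 < g x) (hw0 : ∀ x, 0 ≤ w x)
    (hfb : BddAbove (Set.range f)) (hgb : BddAbove (Set.range g))
    (hfgw : ∀ x y, f x * g y ≤ w ((x + y) / 2) ^ 2) :
    (∫ x, f x) * ∫ x, g x ≤ (∫ x, w x) ^ 2 := by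
  set a := ⨆ x, f x with ha
  set b := ⨆ x, g x with hb
  have ha0 : 0 < a := (hf0 0).trans_le (le_ciSup hfb 0)
  have hb0 : 0 < b := (hg0 0).trans_le (le_ciSup hgb 0)
  set c := Real.sqrt (a * b) with hc
  have hc0 : 0 < c := Real.sqrt_pos.2 (by positivity)
  have hc2 : c ^ 2 = a * b := Real.sq_sqrt (by positivity)
  have h := integral_add_integral_le_of_midpoint (f := fun x => f x / a) (g := fun x => g x / b)
    (w := fun x => w x / c) (by fun_prop) (by fun_prop) (hfi.div_const _) (hgi.div_const _)
    (hwi.div_const _) (fun x => by have := hf0 x; positivity)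
    (fun x => by have := hg0 x; positivity) (fun x => by have := hw0 x; positivity)
    (fun x => (div_le_one ha0).2 (le_ciSup hfb x)) (fun x => (div_le_one hb0).2 (le_ciSup hgb x))
    (fun t ht => by
      obtain ⟨x, hx⟩ := exists_lt_of_lt_ciSup (f := f) (b := t * a) (by nlinarith)
      exact ⟨x, (lt_div_iff₀ ha0).2 hx⟩)
    (fun t ht => by
      obtain ⟨x, hx⟩ := exists_lt_of_lt_ciSup (f := g) (b := t * b) (by nlinarith)
      exact ⟨x, (lt_div_iff₀ hb0).2 hx⟩)
    (fun x y => by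
      rw [div_mul_div_comm, div_pow, hc2]
      gcongr
      exact hfgw x y)
  simp only [integral_div] at h
  set F := ∫ x, f x
  set G := ∫ x, g x
  set W := ∫ x, w x
  have hF : 0 ≤ F := integral_nonneg fun x => (hf0 x).le
  have hG : 0 ≤ G := integral_nonneg fun x => (hg0 x).le
  have h4 : (F / a + G / b) ^ 2 ≤ (2 * (W / c)) ^ 2 := by gcongr
  have h5 : 4 * (F / a * (G / b)) ≤ (F / a + G / b) ^ 2 := by
    nlinarith [sq_nonneg (F / a - G / b)]
  have h6 : F * G / (a * b) ≤ W ^ 2 / (a * b) := by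
    rw [← div_mul_div_comm, ← hc2, ← div_pow]
    nlinarith
  exact (div_le_div_iff_of_pos_right (by positivity)).1 h6

theorem exp_linear_sub_sq_half (a x : ℝ) :
    Real.exp (a * x - x ^ 2 / 2) =
      Real.exp (a ^ 2 / 2) * Real.exp (-(1 / 2) * (x - a) ^ 2) := by
  rw [← Real.exp_add]; congr 1; ring

theorem integrable_exp_linear_sub_sq_half (a : ℝ) :
    Integrable fun x : ℝ => Real.exp (a * x - x ^ 2 / 2) := by
  simp only [exp_linear_sub_sq_half]
  exact ((integrable_exp_neg_mul_sq (b := 1 / 2) (by norm_num)).comp_sub_right a).const_mul _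

theorem integral_exp_linear_sub_sq_half (a : ℝ) :
    ∫ x : ℝ, Real.exp (a * x - x ^ 2 / 2) =
      Real.exp (a ^ 2 / 2) * Real.sqrt (2 * Real.pi) := by
  simp only [exp_linear_sub_sq_half]
  rw [integral_const_mul,
    integral_sub_right_eq_self (fun x : ℝ => Real.exp (-(1 / 2) * x ^ 2)) a, integral_gaussian]
  congr 2; ring

/-- Prékopa–Leindler for finite sums of exponentials with respect to the Gaussian measure. -/
theorem sum_exp_mul_sum_exp_le {S : Type*} [Fintype S] [Nonempty S] (p q r a : S → ℝ) (E : ℝ)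
    (hE : ∀ m d : ℝ, (∑ s, Real.exp (p s + a s * (m + d))) * (∑ s, Real.exp (q s + a s * (m - d)))
      ≤ Real.exp (E + d ^ 2) * (∑ s, Real.exp (r s + a s * m)) ^ 2) :
    (∑ s, Real.exp (p s + a s ^ 2 / 2)) * (∑ s, Real.exp (q s + a s ^ 2 / 2)) ≤
      Real.exp E * (∑ s, Real.exp (r s + a s ^ 2 / 2)) ^ 2 := by
  set φ : (S → ℝ) → ℝ → ℝ := fun p x =>
    ∑ s, Real.exp (p s) * Real.exp (a s * x - x ^ 2 / 2) with hφ
  have hφe : ∀ p x, φ p x = Real.exp (-(x ^ 2 / 2)) * ∑ s, Real.exp (p s + a s * x) := by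
    intro p x
    simp only [hφ, Finset.mul_sum, ← Real.exp_add]
    exact Finset.sum_congr rfl fun s _ => by congr 1; ring
  have hφc : ∀ p, Continuous (φ p) := fun p => by simp only [hφ]; fun_prop
  have hφi : ∀ p, Integrable (φ p) := fun p =>
    integrable_finsetSum _ fun s _ => (integrable_exp_linear_sub_sq_half _).const_mul _
  have hφp : ∀ p x, 0 < φ p x := fun p x =>
    Finset.sum_pos (fun s _ => by positivity) Finset.univ_nonempty
  have hφb : ∀ p, BddAbove (Set.range (φ p)) := by
    rintro p
    refine ⟨∑ s, Real.exp (p s) * Real.exp (a s ^ 2 / 2), ?_⟩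
    rintro _ ⟨x, rfl⟩
    refine Finset.sum_le_sum fun s _ => ?_
    gcongr
    nlinarith [sq_nonneg (a s - x)]
  have hφint : ∀ p, ∫ x, φ p x =
      (∑ s, Real.exp (p s + a s ^ 2 / 2)) * Real.sqrt (2 * Real.pi) := by
    intro p
    simp only [hφ]
    rw [integral_finsetSum _ fun s _ => (integrable_exp_linear_sub_sq_half _).const_mul _,
      Finset.sum_mul]
    refine Finset.sum_congr rfl fun s _ => ?_
    rw [integral_const_mul, integral_exp_linear_sub_sq_half, Real.exp_add]; ring
  have h := integral_mul_integral_le_sq_of_midpoint (hφc p) (hφc q) (hφi p) (hφi q)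
    ((hφi r).const_mul (Real.exp (E / 2))) (hφp p) (hφp q)
    (fun x => (mul_pos (Real.exp_pos _) (hφp r x)).le) (hφb p) (hφb q) (fun x y => by
      have := hE ((x + y) / 2) ((x - y) / 2)
      rw [show (x + y) / 2 + (x - y) / 2 = x by ring,
        show (x + y) / 2 - (x - y) / 2 = y by ring] at this
      rw [hφe, hφe, hφe, mul_pow, mul_pow, ← Real.exp_nat_mul, ← Real.exp_nat_mul,
        mul_mul_mul_comm, ← Real.exp_add]
      refine (mul_le_mul_of_nonneg_left this (Real.exp_pos _).le).trans_eq ?_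
      rw [← mul_assoc, ← mul_assoc, ← Real.exp_add, ← Real.exp_add]
      congr 2
      push_cast
      ring)
  rw [integral_const_mul, hφint, hφint, hφint, mul_pow, mul_pow, ← Real.exp_nat_mul,
    mul_mul_mul_comm, ← sq, ← mul_assoc] at h
  have hpi : 0 < Real.sqrt (2 * Real.pi) ^ 2 := by have := Real.pi_pos; positivity
  have h2 := le_of_mul_le_mul_right h hpi
  rwa [show ((2 : ℕ) : ℝ) * (E / 2) = E by push_cast; ring] at h2

/-- The vector of spins of a configuration. -/
def spins {N : ℕ} (σ : Cfg N) : Fin N → ℝ := fun i => spin (σ i)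

theorem spin_sq (b : Bool) : spin b ^ 2 = 1 := by cases b <;> simp [spin]

/-- The partition function of the Ising model whose interaction is a sum of squares of linear
forms, with an arbitrary external field. -/
def isingZ {N : ℕ} {ι : Type} (b : ι → Fin N → ℝ) (s : Finset ι) (h : Fin N → ℝ) : ℝ :=
  ∑ σ : Cfg N, Real.exp (∑ j ∈ s, (b j ⬝ᵥ spins σ) ^ 2 / 2 + h ⬝ᵥ spins σ)

theorem isingZ_empty {N : ℕ} {ι : Type} (b : ι → Fin N → ℝ) (h : Fin N → ℝ) :
    isingZ b ∅ h = ∏ i, (2 * Real.cosh (h i)) := by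
  have h1 : ∀ i, 2 * Real.cosh (h i) = ∑ c : Bool, Real.exp (h i * spin c) := fun i => by
    simp [Real.cosh_eq, spin, mul_div_cancel₀]
  simp only [h1]
  rw [Finset.prod_univ_sum, Fintype.piFinset_univ]
  simp only [isingZ, dotProduct, spins, Finset.sum_empty, zero_add, Real.exp_sum]

theorem cosh_add_mul_cosh_sub_le (h u : ℝ) :
    Real.cosh (h + u) * Real.cosh (h - u) ≤ Real.exp (u ^ 2) * Real.cosh h ^ 2 := by
  have h1 : Real.cosh u ^ 2 ≤ Real.exp (u ^ 2) := by
    calc Real.cosh u ^ 2 ≤ Real.exp (u ^ 2 / 2) ^ 2 :=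
          pow_le_pow_left₀ (Real.cosh_pos u).le (Real.cosh_le_exp_half_sq u) 2
      _ = Real.exp (u ^ 2) := by rw [← Real.exp_nat_mul]; congr 1; push_cast; ring
  rw [Real.cosh_add, Real.cosh_sub]
  have h2 := Real.cosh_sq h
  have h3 := Real.cosh_sq u
  nlinarith [sq_nonneg (Real.sinh u), sq_nonneg (Real.sinh h), sq_nonneg (Real.cosh h)]

theorem isingZ_add_mul_isingZ_sub_le {N : ℕ} {ι : Type} [DecidableEq ι] (b : ι → Fin N → ℝ)
    (s : Finset ι) (h u : Fin N → ℝ) (C : ℝ)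
    (hC : ∀ d : ι → ℝ, ∑ i, (u i + ∑ j ∈ s, d j * b j i) ^ 2 ≤ C + ∑ j ∈ s, d j ^ 2) :
    isingZ b s (h + u) * isingZ b s (h - u) ≤ Real.exp C * isingZ b s h ^ 2 := by
  induction s using Finset.induction_on generalizing h u C with
  | empty =>
    have hC' := hC 0
    simp only [Finset.sum_empty, add_zero] at hC'
    simp only [isingZ_empty, Pi.add_apply, Pi.sub_apply]
    rw [← Finset.prod_mul_distrib, ← Finset.prod_pow]
    calc ∏ i, 2 * Real.cosh (h i + u i) * (2 * Real.cosh (h i - u i))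
        ≤ ∏ i, Real.exp (u i ^ 2) * (2 * Real.cosh (h i)) ^ 2 := by
          refine Finset.prod_le_prod (fun i _ => ?_) fun i _ => ?_
          · have := Real.cosh_pos (h i + u i)
            have := Real.cosh_pos (h i - u i)
            positivity
          · have := cosh_add_mul_cosh_sub_le (h i) (u i)
            nlinarith
      _ = Real.exp (∑ i, u i ^ 2) * ∏ i, (2 * Real.cosh (h i)) ^ 2 := by
          rw [Finset.prod_mul_distrib, Real.exp_sum]
      _ ≤ _ := by gcongr
  | insert k s hk ih =>
    have hz : ∀ h : Fin N → ℝ, isingZ b (insert k s) h = ∑ σ : Cfg N,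
        Real.exp ((∑ j ∈ s, (b j ⬝ᵥ spins σ) ^ 2 / 2 + h ⬝ᵥ spins σ)
          + (b k ⬝ᵥ spins σ) ^ 2 / 2) := fun h => by
      refine Finset.sum_congr rfl fun σ _ => ?_
      rw [Finset.sum_insert hk]
      congr 1; ring
    have hs : ∀ (h : Fin N → ℝ) (x : ℝ), (∑ σ : Cfg N,
        Real.exp ((∑ j ∈ s, (b j ⬝ᵥ spins σ) ^ 2 / 2 + h ⬝ᵥ spins σ)
          + (b k ⬝ᵥ spins σ) * x)) = isingZ b s (h + x • b k) := fun h x => by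
      refine Finset.sum_congr rfl fun σ _ => ?_
      rw [add_dotProduct, smul_dotProduct, smul_eq_mul]
      congr 1; ring
    rw [hz, hz, hz]
    refine sum_exp_mul_sum_exp_le _ _ _ _ _ fun m d => ?_
    rw [hs, hs, hs]
    have := ih (h + m • b k) (u + d • b k) (C + d ^ 2) fun e => by
      have h1 := hC (Function.update e k d)
      rw [Finset.sum_insert hk] at h1
      have h2 : ∑ j ∈ s, (Function.update e k d j) ^ 2 = ∑ j ∈ s, e j ^ 2 :=
        Finset.sum_congr rfl fun j hj => by
          rw [Function.update_of_ne (ne_of_mem_of_not_mem hj hk)]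
      have h3 : ∀ i, ∑ j ∈ insert k s, Function.update e k d j * b j i =
          d * b k i + ∑ j ∈ s, e j * b j i := fun i => by
        rw [Finset.sum_insert hk, Function.update_self]
        congr 1
        exact Finset.sum_congr rfl fun j hj => by
          rw [Function.update_of_ne (ne_of_mem_of_not_mem hj hk)]
      simp only [h3, h2, Function.update_self] at h1
      simp only [Pi.add_apply, Pi.smul_apply, smul_eq_mul, add_assoc]
      exact h1
    convert this using 3
    all_goals module

open Matrix in
theorem posSemidef_ising_le {N : ℕ} {A : Matrix (Fin N) (Fin N) ℝ} (hA : A.PosSemidef)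
    (hA2 : ∀ x : Fin N → ℝ, x ⬝ᵥ (A *ᵥ x) ≤ (1 / 2) * (x ⬝ᵥ x)) (h u : Fin N → ℝ) :
    (∑ σ : Cfg N, Real.exp (spins σ ⬝ᵥ (A *ᵥ spins σ) / 2 + (h + u) ⬝ᵥ spins σ)) *
      (∑ σ : Cfg N, Real.exp (spins σ ⬝ᵥ (A *ᵥ spins σ) / 2 + (h - u) ⬝ᵥ spins σ)) ≤
    Real.exp (2 * (u ⬝ᵥ u)) *
      (∑ σ : Cfg N, Real.exp (spins σ ⬝ᵥ (A *ᵥ spins σ) / 2 + h ⬝ᵥ spins σ)) ^ 2 := by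
  obtain ⟨m, b, hb⟩ := Matrix.posSemidef_iff_eq_sum_vecMulVec.1 hA
  have hq : ∀ x : Fin N → ℝ, x ⬝ᵥ (A *ᵥ x) = ∑ j, (b j ⬝ᵥ x) ^ 2 := fun x => by
    rw [hb, Matrix.sum_mulVec, dotProduct_sum]
    refine Finset.sum_congr rfl fun j _ => ?_
    rw [Matrix.vecMulVec_mulVec]
    simp [dotProduct_comm x, sq]
  have hz : ∀ h : Fin N → ℝ, (∑ σ : Cfg N,
      Real.exp (spins σ ⬝ᵥ (A *ᵥ spins σ) / 2 + h ⬝ᵥ spins σ)) = isingZ b univ h := fun h => by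
    simp only [isingZ, hq, Finset.sum_div]
  rw [hz, hz, hz]
  refine isingZ_add_mul_isingZ_sub_le b univ h u _ fun d => ?_
  set y : Fin N → ℝ := fun i => ∑ j, d j * b j i with hy
  have hyy : y ⬝ᵥ y = ∑ j, d j * (b j ⬝ᵥ y) := by
    simp only [dotProduct, hy, Finset.mul_sum, Finset.sum_mul]
    rw [Finset.sum_comm]
    refine Finset.sum_congr rfl fun j _ => Finset.sum_congr rfl fun i _ =>
      Finset.sum_congr rfl fun l _ => by ring
  have h1 : y ⬝ᵥ y ≤ ∑ j, d j ^ 2 / 4 + ∑ j, (b j ⬝ᵥ y) ^ 2 := by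
    rw [hyy, ← Finset.sum_add_distrib]
    exact Finset.sum_le_sum fun j _ => by nlinarith [sq_nonneg (d j / 2 - b j ⬝ᵥ y)]
  have h2 := hA2 y
  rw [hq] at h2
  rw [← Finset.sum_div] at h1
  have h3 : ∑ i, (u i + y i) ^ 2 ≤ 2 * (u ⬝ᵥ u) + 2 * (y ⬝ᵥ y) := by
    simp only [dotProduct, Finset.mul_sum, ← Finset.sum_add_distrib]
    exact Finset.sum_le_sum fun i _ => by nlinarith [sq_nonneg (u i - y i)]
  linarith

/-- A pair of independent replicas of a model with sub-Gaussian exponential moments has bounded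
Gaussian exponential moments. -/
theorem sum_exp_sq_le {S : Type*} [Fintype S] (w x : S → ℝ) (W : ℝ) (hw : ∀ s, 0 ≤ w s)
    (hx : ∀ l : ℝ, ∑ s, w s * Real.exp (l * x s) ≤ Real.exp (2 * l ^ 2) * W) :
    ∑ s, w s * Real.exp (16⁻¹ * x s ^ 2) ≤ 2 * W := by
  set r := Real.sqrt (1 / 8) with hr
  have hr2 : r ^ 2 = 1 / 8 := Real.sq_sqrt (by norm_num)
  have hW : 0 ≤ W := by
    have := hx 0
    simp only [zero_mul, Real.exp_zero, mul_one] at this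
    refine le_trans (Finset.sum_nonneg fun s _ => hw s) (this.trans (by simp))
  have hi : ∀ s, Integrable fun y : ℝ => w s * Real.exp (r * x s * y - y ^ 2 / 2) := fun s =>
    (integrable_exp_linear_sub_sq_half _).const_mul _
  have h1 : (∑ s, w s * Real.exp (16⁻¹ * x s ^ 2)) * Real.sqrt (2 * Real.pi) =
      ∫ y : ℝ, ∑ s, w s * Real.exp (r * x s * y - y ^ 2 / 2) := by
    rw [integral_finsetSum _ fun s _ => hi s, Finset.sum_mul]
    refine Finset.sum_congr rfl fun s _ => ?_
    rw [integral_const_mul, integral_exp_linear_sub_sq_half, mul_pow, hr2, mul_assoc]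
    rw [show 16⁻¹ * x s ^ 2 = 1 / 8 * x s ^ 2 / 2 by ring]
  have h2 : ∫ y : ℝ, ∑ s, w s * Real.exp (r * x s * y - y ^ 2 / 2) ≤
      ∫ y : ℝ, W * Real.exp (-(1 / 4) * y ^ 2) := by
    refine integral_mono (integrable_finsetSum _ fun s _ => hi s)
      ((integrable_exp_neg_mul_sq (by norm_num)).const_mul _) fun y => ?_
    have := mul_le_mul_of_nonneg_left (hx (r * y)) (Real.exp_pos (-(y ^ 2 / 2))).le
    convert this using 1
    · rw [Finset.mul_sum]
      refine Finset.sum_congr rfl fun s _ => ?_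
      rw [mul_left_comm, ← Real.exp_add]
      congr 2; ring
    · rw [← mul_assoc, ← Real.exp_add, mul_pow, hr2, mul_comm]
      congr 2; ring
  rw [integral_const_mul, integral_gaussian] at h2
  have h3 : Real.sqrt (Real.pi / (1 / 4)) ≤ 2 * Real.sqrt (2 * Real.pi) := by
    rw [show (2 : ℝ) = Real.sqrt 4 by rw [show (4 : ℝ) = 2 ^ 2 by norm_num]; simp,
      ← Real.sqrt_mul (by norm_num), ← show (2 : ℝ) = Real.sqrt 4 by
        rw [show (4 : ℝ) = 2 ^ 2 by norm_num]; simp]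
    exact Real.sqrt_le_sqrt (by linarith [Real.pi_pos])
  have hpi : 0 < Real.sqrt (2 * Real.pi) := Real.sqrt_pos.2 (by have := Real.pi_pos; positivity)
  refine le_of_mul_le_mul_right (h1.trans_le (h2.trans ?_)) hpi
  nlinarith

/-- The quadratic form of the strictly upper triangular part of `g`. -/
def upperForm {N : ℕ} (g : Fin N → Fin N → ℝ) (x : Fin N → ℝ) : ℝ :=
  ∑ i, ∑ j, if i < j then g i j * x i * x j else 0

theorem upperForm_smul {N : ℕ} (g : Fin N → Fin N → ℝ) (c : ℝ) (x : Fin N → ℝ) :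
    upperForm g (c • x) = c ^ 2 * upperForm g x := by
  simp only [upperForm, Finset.mul_sum, mul_ite, mul_zero, Pi.smul_apply, smul_eq_mul]
  refine Finset.sum_congr rfl fun i _ => Finset.sum_congr rfl fun j _ => ?_
  congr 1; ring

theorem upperForm_neg {N : ℕ} (g : Fin N → Fin N → ℝ) (x : Fin N → ℝ) :
    upperForm (-g) x = -upperForm g x := by
  simp only [upperForm, ← Finset.sum_neg_distrib, Pi.neg_apply]
  refine Finset.sum_congr rfl fun i _ => Finset.sum_congr rfl fun j _ => ?_
  split_ifs <;> ring

theorem upperForm_update {N : ℕ} (g : Fin N → Fin N → ℝ) (x : Fin N → ℝ) (p : Fin N) :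
    ∃ a b : ℝ, ∀ c, upperForm g (Function.update x p c) = a + b * c := by
  have h : ∀ i j : Fin N, ∃ a b : ℝ, ∀ c, (if i < j then
      g i j * Function.update x p c i * Function.update x p c j else 0) = a + b * c := by
    intro i j
    by_cases hij : i < j
    · simp only [hij, if_true]
      by_cases hi : i = p
      · subst hi
        exact ⟨0, g i j * x j, fun c => by
          rw [Function.update_self, Function.update_of_ne hij.ne']; ring⟩
      · by_cases hj : j = p
        · subst hj
          exact ⟨0, g i j * x i, fun c => by
            rw [Function.update_self, Function.update_of_ne hi]; ring⟩
        · exact ⟨g i j * x i * x j, 0, fun c => by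
            rw [Function.update_of_ne hi, Function.update_of_ne hj]; ring⟩
    · exact ⟨0, 0, fun c => by simp [hij]⟩
  choose a b hab using h
  refine ⟨∑ i, ∑ j, a i j, ∑ i, ∑ j, b i j, fun c => ?_⟩
  simp only [upperForm, hab, Finset.sum_add_distrib, Finset.sum_mul]

/-- The coordinates of a point can be rounded one by one to integers without decreasing a function
which is affine in each coordinate. -/
theorem exists_int_rounding {ι : Type*} [Fintype ι] [DecidableEq ι] (F : (ι → ℝ) → ℝ)
    (hF : ∀ x p, ∃ a b : ℝ, ∀ c, F (Function.update x p c) = a + b * c) (y : ι → ℝ) :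
    ∃ k : ι → ℤ, (∀ i, |(k i : ℝ) - y i| ≤ 1) ∧ F y ≤ F fun i => (k i : ℝ) := by
  have main : ∀ s : Finset ι, ∃ z : ι → ℝ, (∀ i ∈ s, ∃ n : ℤ, z i = n) ∧
      (∀ i, |z i - y i| ≤ 1) ∧ (∀ i ∉ s, z i = y i) ∧ F y ≤ F z := by
    intro s
    induction s using Finset.induction_on with
    | empty => exact ⟨y, by simp, by simp, by simp, le_rfl⟩
    | insert p s hp ih =>
      obtain ⟨z, hz1, hz2, hz3, hz4⟩ := ih
      obtain ⟨a, b, hab⟩ := hF z p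
      have hzp := hz3 p hp
      have hself : F z = a + b * y p := by
        rw [← hab, ← hzp, Function.update_eq_self]
      have hn : ∃ n : ℤ, |(n : ℝ) - y p| ≤ 1 ∧ b * y p ≤ b * n := by
        have h1 := Int.floor_le (y p)
        have h2 := Int.lt_floor_add_one (y p)
        rcases le_total 0 b with hb | hb
        · refine ⟨⌊y p⌋ + 1, ?_, ?_⟩
          · push_cast; rw [abs_le]; constructor <;> linarith
          · push_cast; exact mul_le_mul_of_nonneg_left h2.le hb
        · refine ⟨⌊y p⌋, ?_, mul_le_mul_of_nonpos_left h1 hb⟩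
          rw [abs_le]; constructor <;> linarith
      obtain ⟨n, hn1, hn2⟩ := hn
      refine ⟨Function.update z p n, fun i hi => ?_, fun i => ?_, fun i hi => ?_, ?_⟩
      · by_cases h : i = p
        · subst h; exact ⟨n, by simp⟩
        · rw [Function.update_of_ne h]
          exact hz1 i (Finset.mem_of_mem_insert_of_ne hi h)
      · by_cases h : i = p
        · subst h; simpa using hn1
        · rw [Function.update_of_ne h]; exact hz2 i
      · rw [Finset.mem_insert, not_or] at hi
        rw [Function.update_of_ne hi.1]; exact hz3 i hi.2
      · rw [hab]; linarith
  obtain ⟨z, hz1, hz2, -, hz4⟩ := main univ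
  choose k hk using fun i => hz1 i (mem_univ i)
  refine ⟨k, fun i => ?_, ?_⟩
  · rw [← hk]; exact hz2 i
  · simpa only [← hk] using hz4

/-- The integer points of the ball of radius `2 √N`. -/
def gridBall (N : ℕ) : Finset (Fin N → ℤ) :=
  (Fintype.piFinset fun _ => Finset.Icc (-(4 * N : ℕ) : ℤ) (4 * N : ℕ)).filter
    fun k => ∑ i, k i ^ 2 ≤ 4 * N

theorem mem_gridBall {N : ℕ} {k : Fin N → ℤ} : k ∈ gridBall N ↔ ∑ i, k i ^ 2 ≤ 4 * N := by
  simp only [gridBall, Finset.mem_filter, Fintype.mem_piFinset, Finset.mem_Icc, and_iff_right_iff_imp]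
  intro h i
  have h1 : k i ^ 2 ≤ 4 * N :=
    (Finset.single_le_sum (f := fun i => k i ^ 2) (fun i _ => sq_nonneg _) (mem_univ i)).trans h
  have h2 := Int.le_self_sq (k i)
  have h3 := Int.le_self_sq (-k i)
  push_cast
  constructor <;> nlinarith

theorem sum_exp_neg_sq_le (n : ℕ) :
    ∑ k ∈ Finset.Icc (-(n : ℤ)) n, Real.exp (-(k : ℝ) ^ 2) ≤ 3 - 2 * (1 / 2) ^ n := by
  induction n with
  | zero => simp; norm_num
  | succ n ih =>
    have h : Finset.Icc (-((n + 1 : ℕ) : ℤ)) (n + 1 : ℕ) =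
        insert ((n : ℤ) + 1) (insert (-((n : ℤ) + 1)) (Finset.Icc (-(n : ℤ)) n)) := by
      ext x; simp only [Finset.mem_Icc, Finset.mem_insert]; push_cast; omega
    have he : Real.exp (-((n : ℝ) + 1) ^ 2) ≤ (1 / 2) ^ (n + 1) := by
      calc Real.exp (-((n : ℝ) + 1) ^ 2) ≤ Real.exp ((n + 1 : ℕ) * (-1)) := by
            apply Real.exp_le_exp.2; push_cast; nlinarith [Nat.cast_nonneg (α := ℝ) n]
        _ = Real.exp (-1) ^ (n + 1) := Real.exp_nat_mul _ _
        _ ≤ _ := by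
            gcongr
            rw [Real.exp_neg, one_div]
            gcongr
            linarith [Real.add_one_le_exp 1]
    rw [h, Finset.sum_insert, Finset.sum_insert]
    · push_cast
      rw [neg_sq]
      rw [pow_succ (1 / 2 : ℝ)] at he ⊢
      linarith
    · simp
    · simp only [Finset.mem_insert, Finset.mem_Icc]; omega

theorem card_gridBall_le (N : ℕ) : ((gridBall N).card : ℝ) ≤ Real.exp (6 * N) := by
  calc ((gridBall N).card : ℝ) = ∑ k ∈ gridBall N, 1 := by simp
    _ ≤ ∑ k ∈ gridBall N, Real.exp (4 * N) * ∏ i, Real.exp (-(k i : ℝ) ^ 2) := by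
        refine Finset.sum_le_sum fun k hk => ?_
        rw [← Real.exp_sum, ← Real.exp_add, Finset.sum_neg_distrib]
        apply Real.one_le_exp
        have : ((∑ i, k i ^ 2 : ℤ) : ℝ) ≤ ((4 * N : ℤ) : ℝ) :=
          Int.cast_le.2 (mem_gridBall.1 hk)
        push_cast at this
        linarith
    _ ≤ ∑ k ∈ Fintype.piFinset fun _ : Fin N => Finset.Icc (-(4 * N : ℕ) : ℤ) (4 * N : ℕ),
          Real.exp (4 * N) * ∏ i, Real.exp (-(k i : ℝ) ^ 2) :=
        Finset.sum_le_sum_of_subset_of_nonneg (Finset.filter_subset _ _)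
          fun _ _ _ => by positivity
    _ = Real.exp (4 * N) * ∏ _i : Fin N,
          ∑ k ∈ Finset.Icc (-(4 * N : ℕ) : ℤ) (4 * N : ℕ), Real.exp (-(k : ℝ) ^ 2) := by
        rw [← Finset.mul_sum,
          Finset.sum_prod_piFinset _ fun (_ : Fin N) (k : ℤ) => Real.exp (-(k : ℝ) ^ 2)]
    _ ≤ Real.exp (4 * N) * ∏ _i : Fin N, Real.exp 2 := by
        gcongr with i
        have := sum_exp_neg_sq_le (4 * N)
        have h2 := Real.add_one_le_exp 2
        have : (0 : ℝ) < (1 / 2) ^ (4 * N) := by positivity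
        linarith
    _ = Real.exp (6 * N) := by
        rw [Finset.prod_const, Finset.card_univ, Fintype.card_fin, ← Real.exp_nat_mul,
          ← Real.exp_add]
        congr 1; ring

theorem exists_gridBall_of_lt_upperForm {N : ℕ} (hN : 0 < N) (g : Fin N → Fin N → ℝ) {K : ℝ}
    (x : Fin N → ℝ) (hx : K * Real.sqrt N * ∑ i, x i ^ 2 < upperForm g x) :
    ∃ k ∈ gridBall N, K * N ≤ (1 / Real.sqrt N) * upperForm g fun i => (k i : ℝ) := by
  have hN' : (0 : ℝ) < N := Nat.cast_pos.2 hN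
  have hsN : 0 < Real.sqrt N := Real.sqrt_pos.2 hN'
  have hX : 0 < ∑ i, x i ^ 2 := by
    refine lt_of_le_of_ne (Finset.sum_nonneg fun i _ => sq_nonneg _) fun h => ?_
    have h0 : x = 0 := by
      ext i
      simpa using (Finset.sum_eq_zero_iff_of_nonneg fun i _ => sq_nonneg (x i)).1 h.symm i
        (mem_univ i)
    rw [h0] at hx
    simp [upperForm] at hx
  set X := ∑ i, x i ^ 2 with hXdef
  set c := Real.sqrt (N / X) with hc
  have hc2 : c ^ 2 = N / X := Real.sq_sqrt (by positivity)
  obtain ⟨k, hk1, hk2⟩ := exists_int_rounding (upperForm g) (upperForm_update g) (c • x)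
  refine ⟨k, mem_gridBall.2 ?_, ?_⟩
  · have h1 : ∑ i, (k i : ℝ) ^ 2 ≤ ∑ i, (2 * (c * x i) ^ 2 + 2) := by
      refine Finset.sum_le_sum fun i _ => ?_
      have h2 := abs_le.1 (hk1 i)
      simp only [Pi.smul_apply, smul_eq_mul] at h2
      nlinarith [sq_nonneg ((k i : ℝ) - 2 * (c * x i))]
    simp only [mul_pow, Finset.sum_add_distrib, ← Finset.mul_sum, hc2, ← hXdef] at h1
    rw [div_mul_cancel₀ _ hX.ne'] at h1
    simp only [Finset.sum_const, Finset.card_univ, Fintype.card_fin, nsmul_eq_mul] at h1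
    have : ((∑ i, k i ^ 2 : ℤ) : ℝ) ≤ ((4 * N : ℤ) : ℝ) := by push_cast; linarith
    exact Int.cast_le.1 this
  · rw [upperForm_smul, hc2] at hk2
    rw [one_div, inv_mul_eq_div, le_div_iff₀ hsN]
    refine le_trans ?_ hk2
    have := mul_lt_mul_of_pos_left hx (show 0 < N / X by positivity)
    refine le_trans (le_of_eq ?_) this.le
    field_simp

theorem integrable_exp_linear_gaussN (N : ℕ) (c : Fin N → Fin N → ℝ) :
    Integrable (fun g : Fin N → Fin N → ℝ => Real.exp (∑ i, ∑ j, c i j * g i j)) (gaussN N) := by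
  simp only [Real.exp_sum]
  exact Integrable.fintype_prod (f := fun i (x : Fin N → ℝ) => ∏ j, Real.exp (c i j * x j))
    fun i => Integrable.fintype_prod (f := fun j (x : ℝ) => Real.exp (c i j * x))
      fun j => integrable_exp_mul_gaussianReal _

theorem integral_exp_linear_gaussN (N : ℕ) (c : Fin N → Fin N → ℝ) :
    ∫ g : Fin N → Fin N → ℝ, Real.exp (∑ i, ∑ j, c i j * g i j) ∂gaussN N =
      Real.exp (∑ i, ∑ j, c i j ^ 2 / 2) := by
  simp only [Real.exp_sum, gaussN]
  rw [integral_fintype_prod_eq_prod fun i (x : Fin N → ℝ) => ∏ j, Real.exp (c i j * x j)]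
  refine Finset.prod_congr rfl fun i _ => ?_
  rw [integral_fintype_prod_eq_prod fun j (x : ℝ) => Real.exp (c i j * x)]
  refine Finset.prod_congr rfl fun j _ => ?_
  have := mgf_gaussianReal (p := gaussianReal 0 1) (X := id) (μ := 0) (v := 1) (by simp) (c i j)
  simpa [mgf] using this

instance isProbabilityMeasure_gaussN (N : ℕ) : IsProbabilityMeasure (gaussN N) := by
  unfold gaussN; infer_instance

theorem mul_upperForm_eq {N : ℕ} (c : ℝ) (g : Fin N → Fin N → ℝ) (x : Fin N → ℝ) :
    c * upperForm g x = ∑ i, ∑ j, (if i < j then c * x i * x j else 0) * g i j := by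
  simp only [upperForm, Finset.mul_sum]
  refine Finset.sum_congr rfl fun i _ => Finset.sum_congr rfl fun j _ => ?_
  split_ifs <;> ring

theorem integrable_exp_upperForm {N : ℕ} (c : ℝ) (x : Fin N → ℝ) :
    Integrable (fun g => Real.exp (c * upperForm g x)) (gaussN N) := by
  simp only [mul_upperForm_eq]
  exact integrable_exp_linear_gaussN N _

theorem integral_exp_upperForm_le {N : ℕ} (c : ℝ) (x : Fin N → ℝ) :
    ∫ g, Real.exp (c * upperForm g x) ∂gaussN N ≤
      Real.exp (c ^ 2 * (∑ i, x i ^ 2) ^ 2 / 2) := by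
  simp only [mul_upperForm_eq]
  rw [integral_exp_linear_gaussN, Real.exp_le_exp]
  calc ∑ i, ∑ j, (if i < j then c * x i * x j else 0) ^ 2 / 2
      ≤ ∑ i, ∑ j, c ^ 2 * (x i ^ 2 * x j ^ 2) / 2 := by
        refine Finset.sum_le_sum fun i _ => Finset.sum_le_sum fun j _ => ?_
        split_ifs
        · exact le_of_eq (by ring)
        · simp only [ne_eq, OfNat.ofNat_ne_zero, not_false_eq_true, zero_pow, zero_div]
          positivity
    _ = _ := by
        simp only [← Finset.sum_div, ← Finset.mul_sum]
        rw [sq (∑ i, x i ^ 2), Finset.sum_mul_sum]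
        simp only [Finset.mul_sum]

/-- A random variable controlling the operator norm of the interaction matrix. -/
def gridExp (N : ℕ) (g : Fin N → Fin N → ℝ) : ℝ :=
  ∑ k ∈ gridBall N, (Real.exp ((1 / Real.sqrt N) * upperForm g fun i => (k i : ℝ)) +
    Real.exp ((-(1 / Real.sqrt N)) * upperForm g fun i => (k i : ℝ)))

theorem gridExp_nonneg (N : ℕ) (g : Fin N → Fin N → ℝ) : 0 ≤ gridExp N g :=
  Finset.sum_nonneg fun _ _ => by positivity

theorem integrable_gridExp (N : ℕ) : Integrable (gridExp N) (gaussN N) :=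
  integrable_finsetSum _ fun _ _ => (integrable_exp_upperForm _ _).add (integrable_exp_upperForm _ _)

theorem integral_gridExp_le {N : ℕ} (hN : 0 < N) :
    ∫ g, gridExp N g ∂gaussN N ≤ 2 * Real.exp (14 * N) := by
  have hN' : (0 : ℝ) < N := Nat.cast_pos.2 hN
  have hb : ∀ k ∈ gridBall N, ∀ c : ℝ, c ^ 2 = 1 / N →
      ∫ g, Real.exp (c * upperForm g fun i => (k i : ℝ)) ∂gaussN N ≤ Real.exp (8 * N) := by
    intro k hk c hc
    refine (integral_exp_upperForm_le _ _).trans (Real.exp_le_exp.2 ?_)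
    have h1 : ((∑ i, k i ^ 2 : ℤ) : ℝ) ≤ ((4 * N : ℤ) : ℝ) := Int.cast_le.2 (mem_gridBall.1 hk)
    push_cast at h1
    have h2 : (∑ i, (k i : ℝ) ^ 2) ^ 2 ≤ (4 * N) ^ 2 :=
      pow_le_pow_left₀ (Finset.sum_nonneg fun i _ => sq_nonneg _) h1 2
    rw [hc, div_mul_eq_mul_div, one_mul, div_div, div_le_iff₀ (by positivity)]
    nlinarith
  have hs : (1 / Real.sqrt N) ^ 2 = 1 / N := by
    rw [div_pow, Real.sq_sqrt hN'.le, one_pow]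
  calc ∫ g, gridExp N g ∂gaussN N = ∑ k ∈ gridBall N, ∫ g,
          (Real.exp ((1 / Real.sqrt N) * upperForm g fun i => (k i : ℝ)) +
            Real.exp ((-(1 / Real.sqrt N)) * upperForm g fun i => (k i : ℝ))) ∂gaussN N :=
        integral_finsetSum _ fun _ _ =>
          (integrable_exp_upperForm _ _).add (integrable_exp_upperForm _ _)
    _ ≤ ∑ _k ∈ gridBall N, (Real.exp (8 * N) + Real.exp (8 * N)) := by
        refine Finset.sum_le_sum fun k hk => ?_
        rw [integral_add (integrable_exp_upperForm _ _) (integrable_exp_upperForm _ _)]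
        exact add_le_add (hb k hk _ hs) (hb k hk _ (by rw [neg_sq, hs]))
    _ = 2 * ((gridBall N).card * Real.exp (8 * N)) := by
        rw [Finset.sum_const, nsmul_eq_mul]; ring
    _ ≤ 2 * (Real.exp (6 * N) * Real.exp (8 * N)) := by
        gcongr; exact card_gridBall_le N
    _ = _ := by rw [← Real.exp_add]; congr 2; ring

theorem exp_le_gridExp {N : ℕ} (hN : 0 < N) (g : Fin N → Fin N → ℝ) {K : ℝ} (x : Fin N → ℝ)
    (hx : K * Real.sqrt N * ∑ i, x i ^ 2 < |upperForm g x|) :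
    Real.exp (K * N) ≤ gridExp N g := by
  have hle : ∀ k ∈ gridBall N, Real.exp ((1 / Real.sqrt N) * upperForm g fun i => (k i : ℝ)) +
      Real.exp ((-(1 / Real.sqrt N)) * upperForm g fun i => (k i : ℝ)) ≤ gridExp N g :=
    fun k hk => Finset.single_le_sum (f := fun k : Fin N → ℤ =>
      Real.exp ((1 / Real.sqrt N) * upperForm g fun i => (k i : ℝ)) +
      Real.exp ((-(1 / Real.sqrt N)) * upperForm g fun i => (k i : ℝ)))
      (fun _ _ => by positivity) hk
  rcases lt_abs.1 hx with h | h
  · obtain ⟨k, hk, hk2⟩ := exists_gridBall_of_lt_upperForm hN g x h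
    exact (Real.exp_le_exp.2 hk2).trans
      ((le_add_of_nonneg_right (Real.exp_pos _).le).trans (hle k hk))
  · obtain ⟨k, hk, hk2⟩ := exists_gridBall_of_lt_upperForm hN (-g) x (by rwa [upperForm_neg])
    rw [upperForm_neg, mul_neg, ← neg_mul] at hk2
    exact (Real.exp_le_exp.2 hk2).trans
      ((le_add_of_nonneg_left (Real.exp_pos _).le).trans (hle k hk))

theorem negH_eq (N : ℕ) (β h : ℝ) (g : Fin N → Fin N → ℝ) (σ : Cfg N) :
    negH N β h g σ = β / Real.sqrt N * upperForm g (spins σ) + (fun _ => h) ⬝ᵥ spins σ := by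
  simp only [negH, upperForm, spins, dotProduct, Finset.mul_sum]

/-- Two replicas, indexed by `Fin 1 × Fin 2`, as a pair of configurations. -/
def replicaPair (N : ℕ) : (Fin 1 × Fin 2 → Cfg N) ≃ Cfg N × Cfg N :=
  ((Equiv.uniqueProd (Fin 2) (Fin 1)).arrowCongr (Equiv.refl _)).trans (finTwoArrowEquiv _)

theorem gibbs_Sbar_eq (N : ℕ) (β h : ℝ) (g : Fin N → Fin N → ℝ) (t : Fin N → ℝ) (c : ℝ) :
    gibbs N β h g (fun σs : Fin 1 × Fin 2 → Cfg N => Real.exp (c * Sbar N 1 t σs 0 ^ 2)) =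
      (∑ p : Cfg N × Cfg N, Real.exp (negH N β h g p.1) * Real.exp (negH N β h g p.2) *
        Real.exp (c * (t ⬝ᵥ spins p.1 - t ⬝ᵥ spins p.2) ^ 2)) /
      (∑ σ : Cfg N, Real.exp (negH N β h g σ)) ^ 2 := by
  unfold gibbs
  congr 1
  refine Fintype.sum_equiv (replicaPair N) _ _ fun σs => ?_
  have h1 : (replicaPair N σs).1 = σs (0, 0) := rfl
  have h2 : (replicaPair N σs).2 = σs (0, 1) := rfl
  rw [h1, h2, Fintype.prod_prod_type, mul_comm]
  simp only [Finset.univ_unique, Finset.prod_singleton, Fin.prod_univ_two, Sbar, dotProduct,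
    spins, mul_sub, Finset.sum_sub_distrib]
  rfl

open Matrix in
theorem gibbs_exp_Sbar_le_of_upperForm_le {N : ℕ} (β h : ℝ) (g : Fin N → Fin N → ℝ)
    (t : Fin N → ℝ) (ht : ∑ i, t i ^ 2 = 1)
    (hg : ∀ x : Fin N → ℝ, |β / Real.sqrt N * upperForm g x| ≤ (1 / 8) * ∑ i, x i ^ 2) :
    gibbs N β h g
      (fun σs : Fin 1 × Fin 2 → Cfg N => Real.exp (16⁻¹ * Sbar N 1 t σs 0 ^ 2)) ≤ 2 := by
  set c := β / Real.sqrt N with hc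
  set U : Matrix (Fin N) (Fin N) ℝ := fun i j => if i < j then g i j else 0 with hU
  set A : Matrix (Fin N) (Fin N) ℝ := c • (U + Uᵀ) + (1 / 4 : ℝ) • 1 with hA
  have hUq : ∀ x : Fin N → ℝ, x ⬝ᵥ (U *ᵥ x) = upperForm g x := fun x => by
    simp only [dotProduct, mulVec, upperForm, Finset.mul_sum, hU]
    refine Finset.sum_congr rfl fun i _ => Finset.sum_congr rfl fun j _ => ?_
    split_ifs <;> ring
  have hAq : ∀ x : Fin N → ℝ, x ⬝ᵥ (A *ᵥ x) = 2 * (c * upperForm g x) + (1 / 4) * (x ⬝ᵥ x) := by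
    intro x
    have hT : x ⬝ᵥ (Uᵀ *ᵥ x) = upperForm g x := by
      rw [mulVec_transpose, dotProduct_comm, ← dotProduct_mulVec, hUq]
    rw [hA, add_mulVec, smul_mulVec, smul_mulVec, add_mulVec, one_mulVec, dotProduct_add,
      dotProduct_smul, dotProduct_smul, dotProduct_add, hT, hUq]
    simp only [smul_eq_mul]; ring
  have hxx : ∀ x : Fin N → ℝ, x ⬝ᵥ x = ∑ i, x i ^ 2 := fun x => by simp only [dotProduct, sq]
  have hpsd : A.PosSemidef := by
    refine PosSemidef.of_dotProduct_mulVec_nonneg ?_ fun x => ?_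
    · rw [IsHermitian, conjTranspose_eq_transpose_of_trivial, hA]
      simp [transpose_add, add_comm]
    · rw [star_trivial, hAq, hxx]
      have := (abs_le.1 (hg x)).1
      linarith
  have hle : ∀ x : Fin N → ℝ, x ⬝ᵥ (A *ᵥ x) ≤ (1 / 2) * (x ⬝ᵥ x) := fun x => by
    rw [hAq, hxx]
    have := (abs_le.1 (hg x)).2
    linarith
  have hH : ∀ σ, Real.exp (negH N β h g σ) = Real.exp (-(N / 8 : ℝ)) *
      Real.exp (spins σ ⬝ᵥ (A *ᵥ spins σ) / 2 + (fun _ => h) ⬝ᵥ spins σ) := fun σ => by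
    rw [negH_eq, ← Real.exp_add, hAq, hxx]
    have : ∑ i, spins σ i ^ 2 = N := by simp [spins, spin_sq]
    rw [this]
    congr 1; ring
  rw [gibbs_Sbar_eq]
  have hZ : 0 < ∑ σ : Cfg N, Real.exp (negH N β h g σ) :=
    Finset.sum_pos (fun _ _ => Real.exp_pos _) Finset.univ_nonempty
  rw [div_le_iff₀ (by positivity)]
  refine sum_exp_sq_le (fun p : Cfg N × Cfg N =>
    Real.exp (negH N β h g p.1) * Real.exp (negH N β h g p.2))
    (fun p => t ⬝ᵥ spins p.1 - t ⬝ᵥ spins p.2) _ (fun p => by positivity) fun l => ?_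
  have key := posSemidef_ising_le hpsd hle (fun _ => h) (l • t)
  have hu : (l • t) ⬝ᵥ (l • t) = l ^ 2 := by
    rw [smul_dotProduct, dotProduct_smul, hxx, ht]; simp [sq]
  rw [hu] at key
  have hprod : ∑ p : Cfg N × Cfg N, Real.exp (negH N β h g p.1) * Real.exp (negH N β h g p.2) *
      Real.exp (l * (t ⬝ᵥ spins p.1 - t ⬝ᵥ spins p.2)) =
      Real.exp (-(N / 8 : ℝ)) ^ 2 *
      ((∑ σ : Cfg N, Real.exp (spins σ ⬝ᵥ (A *ᵥ spins σ) / 2 +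
          ((fun _ => h) + l • t) ⬝ᵥ spins σ)) *
        ∑ σ : Cfg N, Real.exp (spins σ ⬝ᵥ (A *ᵥ spins σ) / 2 +
          ((fun _ => h) - l • t) ⬝ᵥ spins σ)) := by
    rw [Finset.sum_mul_sum, Fintype.sum_prod_type, Finset.mul_sum]
    refine Finset.sum_congr rfl fun σ _ => ?_
    rw [Finset.mul_sum]
    refine Finset.sum_congr rfl fun τ _ => ?_
    rw [hH, hH, sq, add_dotProduct, sub_dotProduct, smul_dotProduct, smul_dotProduct]
    simp only [← Real.exp_add, smul_eq_mul]
    congr 1; ring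
  have hsum : ∑ σ : Cfg N, Real.exp (negH N β h g σ) = Real.exp (-(N / 8 : ℝ)) *
      ∑ σ : Cfg N, Real.exp (spins σ ⬝ᵥ (A *ᵥ spins σ) / 2 + (fun _ => h) ⬝ᵥ spins σ) := by
    rw [Finset.mul_sum]
    exact Finset.sum_congr rfl fun σ _ => hH σ
  rw [hprod, hsum, mul_pow]
  exact (mul_le_mul_of_nonneg_left key (by positivity)).trans_eq (by ring)

theorem gibbs_exp_Sbar_nonneg (N : ℕ) (β h : ℝ) (g : Fin N → Fin N → ℝ) (t : Fin N → ℝ) (c : ℝ) :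
    0 ≤ gibbs N β h g
      (fun σs : Fin 1 × Fin 2 → Cfg N => Real.exp (c * Sbar N 1 t σs 0 ^ 2)) := by
  rw [gibbs_Sbar_eq]
  exact div_nonneg (Finset.sum_nonneg fun _ _ => by positivity) (by positivity)

theorem gibbs_exp_Sbar_le_exp (N : ℕ) (β h : ℝ) (g : Fin N → Fin N → ℝ) (t : Fin N → ℝ)
    (ht : ∑ i, t i ^ 2 = 1) {c : ℝ} (hc : 0 ≤ c) :
    gibbs N β h g
      (fun σs : Fin 1 × Fin 2 → Cfg N => Real.exp (c * Sbar N 1 t σs 0 ^ 2)) ≤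
      Real.exp (c * (4 * N)) := by
  rw [gibbs_Sbar_eq]
  have hZ : 0 < ∑ σ : Cfg N, Real.exp (negH N β h g σ) :=
    Finset.sum_pos (fun _ _ => Real.exp_pos _) Finset.univ_nonempty
  rw [div_le_iff₀ (by positivity), sq, Finset.sum_mul_sum, ← Finset.sum_product',
    Finset.univ_product_univ, Finset.mul_sum]
  refine Finset.sum_le_sum fun p _ => ?_
  rw [mul_comm]
  gcongr
  rw [← dotProduct_sub]
  calc (t ⬝ᵥ (spins p.1 - spins p.2)) ^ 2
      ≤ (∑ i, t i ^ 2) * ∑ i, (spins p.1 - spins p.2) i ^ 2 := Finset.sum_mul_sq_le_sq_mul_sq _ _ _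
    _ ≤ 1 * ∑ _i : Fin N, 4 := by
        rw [ht]
        gcongr with i
        simp only [Pi.sub_apply, spins]
        cases p.1 i <;> cases p.2 i <;> norm_num [spin]
    _ = 4 * N := by simp [mul_comm]

theorem gibbs_exp_Sbar_le {N : ℕ} (hN : 0 < N) {β : ℝ} (hβ : 0 < β) (hβ' : β ≤ 1 / 120) (h : ℝ)
    (g : Fin N → Fin N → ℝ) (t : Fin N → ℝ) (ht : ∑ i, t i ^ 2 = 1) :
    gibbs N β h g
      (fun σs : Fin 1 × Fin 2 → Cfg N => Real.exp (16⁻¹ * Sbar N 1 t σs 0 ^ 2)) ≤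
      2 + Real.exp (-(14 * N)) * gridExp N g := by
  have hG := gridExp_nonneg N g
  have hN' : (0 : ℝ) < N := Nat.cast_pos.2 hN
  have hsN : 0 < Real.sqrt N := Real.sqrt_pos.2 hN'
  by_cases hg : ∀ x : Fin N → ℝ, |upperForm g x| ≤ 15 * Real.sqrt N * ∑ i, x i ^ 2
  · refine (gibbs_exp_Sbar_le_of_upperForm_le β h g t ht fun x => ?_).trans
      (le_add_of_nonneg_right (by positivity))
    rw [abs_mul, abs_of_pos (div_pos hβ hsN), div_mul_eq_mul_div, div_le_iff₀ hsN]
    have hX : 0 ≤ ∑ i, x i ^ 2 := Finset.sum_nonneg fun i _ => sq_nonneg _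
    calc β * |upperForm g x| ≤ 1 / 120 * (15 * Real.sqrt N * ∑ i, x i ^ 2) := by
          gcongr; exact hg x
      _ = _ := by ring
  · push Not at hg
    obtain ⟨x, hx⟩ := hg
    have h1 := exp_le_gridExp hN g x hx
    calc _ ≤ Real.exp (16⁻¹ * (4 * N)) := gibbs_exp_Sbar_le_exp N β h g t ht (by norm_num)
      _ ≤ Real.exp (-(14 * N)) * Real.exp (15 * N) := by
          rw [← Real.exp_add]; apply Real.exp_le_exp.2; linarith
      _ ≤ Real.exp (-(14 * N)) * gridExp N g := by gcongr
      _ ≤ _ := by linarith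

/-- exponential integrability form:
`ν(exp(L⁻¹ (Σ_i t_i σ̄_i)²)) ≤ L` uniformly in `N`, `h` and `(t_i)` with `Σ t_i² = 1`. -/
theorem stmt3 :
    ∃ β₀ L : ℝ, 0 < β₀ ∧ 0 < L ∧
      ∀ β : ℝ, 0 < β → β ≤ β₀ → ∀ h : ℝ, 0 ≤ h → ∀ M : ℕ,
        ∀ t : Fin (M + 1) → ℝ, (∑ i, t i ^ 2) = 1 →
          nu (M + 1) β h
              (fun σs : Fin 1 × Fin 2 → Cfg (M + 1) =>
                Real.exp (L⁻¹ * Sbar (M + 1) 1 t σs 0 ^ 2)) ≤ L := by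
  refine ⟨1 / 120, 16, by norm_num, by norm_num, fun β hβ hβ' h _ M t ht => ?_⟩
  have hi := (integrable_gridExp (M + 1)).const_mul (Real.exp (-(14 * (M + 1 : ℕ))))
  calc nu (M + 1) β h _
      ≤ ∫ g, (2 + Real.exp (-(14 * (M + 1 : ℕ))) * gridExp (M + 1) g) ∂gaussN (M + 1) :=
        integral_mono_of_nonneg (ae_of_all _ fun g => gibbs_exp_Sbar_nonneg _ _ _ _ _ _)
          ((integrable_const _).add hi)
          (ae_of_all _ fun g => gibbs_exp_Sbar_le M.succ_pos hβ hβ' h g t ht)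
    _ = 2 + Real.exp (-(14 * (M + 1 : ℕ))) * ∫ g, gridExp (M + 1) g ∂gaussN (M + 1) := by
        rw [integral_add (integrable_const _) hi, integral_const_mul]
        simp
    _ ≤ 2 + Real.exp (-(14 * (M + 1 : ℕ))) * (2 * Real.exp (14 * (M + 1 : ℕ))) := by
        gcongr; exact integral_gridExp_le M.succ_pos
    _ = 4 := by
        rw [mul_left_comm, ← Real.exp_add, neg_add_cancel, Real.exp_zero]; norm_num
    _ ≤ 16 := by norm_num

end
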